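/- arXiv:1007.5508 — 2 statements merged into one kernel-verified Lean document; each statement's English description precedes it below -/
import Mathlib

section
/- There is an isomorphism of R_f-modules between I_f^{n−2} and Hom_ℤ(R_f, ℤ), where R_f acts on Hom_ℤ(R_f, ℤ) by (r·φ)(s) := φ(rs); in other words, I_f^{n−2} is in the class of the inverse different of R_f. -/
open Polynomial

noncomputable section

/-- The polynomial `f₀ Tⁿ + f₁ Tⁿ⁻¹ + ⋯ + fₙ` over `ℚ`. -/
def fpoly (n : ℕ) (f : ℕ → ℤ) : Polynomial ℚ :=
  ∑ i ∈ Finset.range (n + 1), Polynomial.C (f i : ℚ) * Polynomial.X ^ (n - i)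

/-- `Q_f = ℚ[T]/(f₀ Tⁿ + ⋯ + fₙ)`. -/
abbrev Qf (n : ℕ) (f : ℕ → ℤ) := AdjoinRoot (fpoly n f)

/-- `θ`, the image of `T` in `Q_f`. -/
def th (n : ℕ) (f : ℕ → ℤ) : Qf n f := AdjoinRoot.root _

/-- `ζ₀ = 1`, and `ζ_k = f₀ θ^k + f₁ θ^(k-1) + ⋯ + f_(k-1) θ` for `k ≥ 1`. -/
def zeta (n : ℕ) (f : ℕ → ℤ) (k : ℕ) : Qf n f :=
  if k = 0 then 1 else ∑ i ∈ Finset.range k, (f i : Qf n f) * th n f ^ (k - i)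

/-- `R_f`, the ℤ-span of `ζ₀, …, ζ_(n-1)` in `Q_f`. -/
def Rf (n : ℕ) (f : ℕ → ℤ) : Submodule ℤ (Qf n f) :=
  Submodule.span ℤ (Set.range fun k : Fin n => zeta n f k)

/-- `I_f^k`, the `k`-th power of the `R_f`-module `I_f = (1, θ)` under multiplication of
ℤ-submodules of `Q_f` (with `I_f^0 = R_f`). -/
def Ifpow (n : ℕ) (f : ℕ → ℤ) (k : ℕ) : Submodule ℤ (Qf n f) :=
  Rf n f * (Submodule.span ℤ {1, th n f}) ^ k

/-- Two families that are biorthogonal for the pairing `(x, s) ↦ L (x * s)` span lattices that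
are dual to each other under this pairing. -/
theorem exists_linearEquiv_dual_of_biorthogonal {A ι : Type*} [CommRing A] [Fintype ι]
    [DecidableEq ι] (L : A →ₗ[ℤ] ℚ) (d z : ι → A)
    (h : ∀ i j, L (d i * z j) = if i = j then 1 else 0) :
    ∃ e : Submodule.span ℤ (Set.range d) ≃ₗ[ℤ] (Submodule.span ℤ (Set.range z) →ₗ[ℤ] ℤ),
      ∀ x s, (e x s : ℚ) = L ((x : A) * (s : A)) := by
  have hd : LinearIndependent ℤ d := by
    rw [Fintype.linearIndependent_iff]
    intro c hc j
    have := congrArg (fun x => L (x * z j)) hc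
    simpa [-zsmul_eq_mul, Finset.sum_mul, smul_mul_assoc, h] using this
  have hz : LinearIndependent ℤ z := by
    rw [Fintype.linearIndependent_iff]
    intro c hc j
    have := congrArg (fun x => L (d j * x)) hc
    simpa [-zsmul_eq_mul, Finset.mul_sum, mul_smul_comm, h] using this
  let bd := Module.Basis.span hd
  let bz := Module.Basis.span hz
  let e := bd.equiv bz.dualBasis (Equiv.refl ι)
  have he : ∀ i j, e (bd i) (bz j) = if i = j then 1 else 0 := by
    intro i j
    simp [e, Finsupp.single_apply, eq_comm]
  have hbd : ∀ i, (bd i : A) = d i := fun i => congrArg Subtype.val (Module.Basis.span_apply hd i)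
  have hbz : ∀ i, (bz i : A) = z i := fun i => congrArg Subtype.val (Module.Basis.span_apply hz i)
  refine ⟨e, fun x s => ?_⟩
  rw [← bd.sum_repr x, ← bz.sum_repr s]
  simp only [map_sum, map_smul, LinearMap.sum_apply, LinearMap.smul_apply,
    Submodule.coe_sum, Submodule.coe_smul, Finset.sum_mul, Finset.mul_sum, smul_mul_assoc,
    mul_smul_comm, hbd, hbz, h, he]
  simp only [smul_eq_mul, zsmul_eq_mul, Int.cast_mul, Int.cast_sum, Int.cast_ite, Int.cast_one,
    Int.cast_zero]

theorem fpoly_natDegree (n : ℕ) (f : ℕ → ℤ) (hf0 : f 0 ≠ 0) : (fpoly n f).natDegree = n := by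
  apply le_antisymm
  · refine Polynomial.natDegree_sum_le_of_forall_le _ _ fun i _ => ?_
    exact (Polynomial.natDegree_C_mul_X_pow_le _ _).trans (Nat.sub_le _ _)
  · apply Polynomial.le_natDegree_of_ne_zero
    have : (fpoly n f).coeff n = f 0 := by
      rw [fpoly, Polynomial.finsetSum_coeff, Finset.sum_eq_single 0]
      · simp
      · intro i hi hi0
        rw [Finset.mem_range] at hi
        rw [Polynomial.coeff_C_mul_X_pow, if_neg (by omega)]
      · simp
    rw [this]
    exact_mod_cast hf0

/-- A functional reading off the coefficient of `θ^(n-1)`, divided by `f₀`. -/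
theorem exists_top_coeff_functional (n : ℕ) (f : ℕ → ℤ) (hf0 : f 0 ≠ 0) :
    ∃ L : Qf n f →ₗ[ℚ] ℚ,
      ∀ i < n, L (th n f ^ i) = if i + 1 = n then (f 0 : ℚ)⁻¹ else 0 := by
  have hdeg := fpoly_natDegree n f hf0
  have hne : fpoly n f ≠ 0 := by
    intro h
    rcases Nat.eq_zero_or_pos n with rfl | hn
    · simp [fpoly, hf0] at h
    · rw [h, Polynomial.natDegree_zero] at hdeg
      omega
  let b := AdjoinRoot.powerBasis hne
  have hdim : b.dim = n := hdeg
  refine ⟨b.basis.constr ℚ fun i => if (i : ℕ) + 1 = n then (f 0 : ℚ)⁻¹ else 0, fun i hi => ?_⟩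
  have : th n f ^ i = b.basis ⟨i, hi.trans_eq hdim.symm⟩ := by
    rw [PowerBasis.basis_eq_pow]
    rfl
  rw [this, Module.Basis.constr_basis]

/-- `f₀ θ^k + f₁ θ^(k-1) + ⋯ + f_k`. -/
def truncTh (n : ℕ) (f : ℕ → ℤ) (k : ℕ) : Qf n f :=
  ∑ i ∈ Finset.range (k + 1), (f i : Qf n f) * th n f ^ (k - i)

theorem truncTh_self (n : ℕ) (f : ℕ → ℤ) : truncTh n f n = 0 := by
  have h : AdjoinRoot.mk (fpoly n f) (fpoly n f) = 0 := AdjoinRoot.mk_self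
  conv_lhs at h =>
    arg 2
    rw [fpoly.eq_def]
  rw [truncTh, ← h, map_sum]
  refine Finset.sum_congr rfl fun i _ => ?_
  simp [th]

theorem truncTh_succ (n : ℕ) (f : ℕ → ℤ) (k : ℕ) :
    truncTh n f (k + 1) = th n f * truncTh n f k + (f (k + 1) : Qf n f) := by
  rw [truncTh, Finset.sum_range_succ, truncTh, Finset.mul_sum, Nat.sub_self, pow_zero, mul_one]
  congr 1
  refine Finset.sum_congr rfl fun i hi => ?_
  rw [Finset.mem_range] at hi
  rw [show k + 1 - i = (k - i) + 1 by omega, pow_succ]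
  ring

theorem zeta_eq_truncTh_sub (n : ℕ) (f : ℕ → ℤ) {k : ℕ} (hk : k ≠ 0) :
    zeta n f k = truncTh n f k - (f k : Qf n f) := by
  rw [zeta, if_neg hk, truncTh, Finset.sum_range_succ]
  simp

theorem pow_succ_mul_truncTh (n : ℕ) (f : ℕ → ℤ) (i k : ℕ) :
    th n f ^ (i + 1) * truncTh n f k =
      th n f ^ i * truncTh n f (k + 1) - (f (k + 1) : ℤ) • th n f ^ i := by
  rw [truncTh_succ, zsmul_eq_mul]
  ring

/-- The family dual to `ζ₀, …, ζ_(n-1)`. -/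
def dualZeta (n : ℕ) (f : ℕ → ℤ) (k : ℕ) : Qf n f :=
  if k = 0 then truncTh n f (n - 1) else th n f ^ (n - 1 - k)

section Functional

variable {n : ℕ} {f : ℕ → ℤ} {L : Qf n f →ₗ[ℚ] ℚ}

theorem map_truncTh (hf0 : f 0 ≠ 0)
    (hL : ∀ i < n, L (th n f ^ i) = if i + 1 = n then (f 0 : ℚ)⁻¹ else 0) {k : ℕ} (hk : k ≤ n) :
    L (truncTh n f k) = if k + 1 = n then 1 else 0 := by
  rcases hk.eq_or_lt with rfl | hk
  · simp [truncTh_self]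
  · rw [truncTh, map_sum, Finset.sum_eq_single 0]
    · rw [← zsmul_eq_mul, map_zsmul, Nat.sub_zero, hL k hk]
      have : (f 0 : ℚ) ≠ 0 := by exact_mod_cast hf0
      split_ifs <;> simp [this]
    · intro i hi hi0
      rw [Finset.mem_range] at hi
      rw [← zsmul_eq_mul, map_zsmul, hL _ (by omega), if_neg (by omega), smul_zero]
    · simp

theorem map_pow_mul_truncTh (hf0 : f 0 ≠ 0)
    (hL : ∀ i < n, L (th n f ^ i) = if i + 1 = n then (f 0 : ℚ)⁻¹ else 0) {i k : ℕ} (hi : i < n)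
    (hk : k ≤ n) : L (th n f ^ i * truncTh n f k) = if i + k + 1 = n then 1 else 0 := by
  induction i generalizing k with
  | zero => simpa using map_truncTh hf0 hL hk
  | succ i ih =>
    rcases hk.eq_or_lt with rfl | hk
    · rw [truncTh_self, mul_zero, map_zero, if_neg (by omega)]
    · rw [pow_succ_mul_truncTh, map_sub, map_zsmul, ih (by omega) hk, hL i (by omega),
        if_neg (show ¬ i + 1 = n by omega), smul_zero, sub_zero]
      congr 1
      rw [show i + (k + 1) + 1 = i + 1 + k + 1 by omega]

theorem map_dualZeta_mul_zeta (hn : 2 ≤ n) (hf0 : f 0 ≠ 0)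
    (hL : ∀ i < n, L (th n f ^ i) = if i + 1 = n then (f 0 : ℚ)⁻¹ else 0) {i k : ℕ} (hi : i < n)
    (hk : k < n) : L (dualZeta n f i * zeta n f k) = if i = k then 1 else 0 := by
  rcases Nat.eq_zero_or_pos i with rfl | hi0 <;> rcases Nat.eq_zero_or_pos k with rfl | hk0
  · rw [dualZeta, if_pos rfl, zeta, if_pos rfl, mul_one, map_truncTh hf0 hL (by omega),
      if_pos (by omega), if_pos rfl]
  · obtain ⟨m, rfl⟩ : ∃ m, k = m + 1 := ⟨k - 1, by omega⟩
    have hz : zeta n f (m + 1) = th n f * truncTh n f m := by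
      rw [zeta_eq_truncTh_sub n f (by omega), truncTh_succ]
      ring
    have hθ : truncTh n f (n - 1) * th n f = -(f n : Qf n f) := by
      have h := truncTh_succ n f (n - 1)
      rw [show n - 1 + 1 = n by omega, truncTh_self] at h
      linear_combination -h
    rw [dualZeta, if_pos rfl, hz, ← mul_assoc, hθ, neg_mul, ← zsmul_eq_mul, map_neg, map_zsmul,
      map_truncTh hf0 hL (by omega), if_neg (by omega), if_neg (by omega), smul_zero, neg_zero]
  · rw [dualZeta, if_neg (by omega), zeta, if_pos rfl, mul_one, hL _ (by omega),
      if_neg (by omega), if_neg (by omega)]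
  · rw [dualZeta, if_neg (by omega), zeta_eq_truncTh_sub n f (by omega), mul_sub,
      mul_comm _ (f k : Qf n f), ← zsmul_eq_mul, map_sub, map_zsmul, hL _ (by omega),
      map_pow_mul_truncTh hf0 hL (by omega) hk.le, if_neg (show ¬ n - 1 - i + 1 = n by omega),
      smul_zero, sub_zero]
    congr 1
    rw [eq_iff_iff]
    omega

end Functional

theorem span_one_pair_pow {A : Type*} [CommRing A] (a : A) (k : ℕ) :
    (Submodule.span ℤ {1, a}) ^ k = Submodule.span ℤ ((fun i => a ^ i) '' Set.Iic k) := by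
  apply le_antisymm
  · induction k with
    | zero =>
      rw [pow_zero, Submodule.one_le]
      exact Submodule.subset_span ⟨0, by simp⟩
    | succ k ih =>
      rw [pow_succ]
      refine (mul_le_mul_left ih _).trans ?_
      rw [Submodule.span_mul_span, Submodule.span_le]
      rintro _ ⟨_, ⟨i, hi, rfl⟩, y, hy, rfl⟩
      rw [Set.mem_Iic] at hi
      apply Submodule.subset_span
      rcases hy with rfl | rfl
      · exact ⟨i, Set.mem_Iic.2 (by omega), by simp⟩
      · exact ⟨i + 1, Set.mem_Iic.2 (by omega), by simp [pow_succ]⟩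
  · rw [Submodule.span_le]
    rintro _ ⟨i, hi, rfl⟩
    obtain ⟨m, rfl⟩ := Nat.exists_eq_add_of_le (Set.mem_Iic.1 hi)
    have h1 := Submodule.pow_mem_pow (Submodule.span ℤ {1, a})
      (Submodule.subset_span (show a ∈ ({1, a} : Set A) by simp)) i
    have h2 := Submodule.pow_mem_pow (Submodule.span ℤ {1, a})
      (Submodule.subset_span (show (1 : A) ∈ ({1, a} : Set A) by simp)) m
    simpa [pow_add] using Submodule.mul_mem_mul h1 h2

theorem pow_mem_span_dualZeta (n : ℕ) (f : ℕ → ℤ) {i : ℕ} (hi : i + 2 ≤ n) :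
    th n f ^ i ∈ Submodule.span ℤ (Set.range fun k : Fin n => dualZeta n f k) := by
  refine Submodule.subset_span ⟨⟨n - 1 - i, by omega⟩, ?_⟩
  simp only [dualZeta]
  rw [if_neg (by omega)]
  congr 1
  omega

theorem pow_mul_truncTh_mem_span_dualZeta (n : ℕ) (f : ℕ → ℤ) {i k : ℕ} (hi : i + 2 ≤ n)
    (hk : k ≤ n) :
    th n f ^ i * truncTh n f k ∈
      Submodule.span ℤ (Set.range fun k : Fin n => dualZeta n f k) := by
  induction i generalizing k with
  | zero =>
    rw [pow_zero, one_mul]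
    rcases hk.eq_or_lt with rfl | hk
    · simp [truncTh_self]
    · by_cases hk1 : k = n - 1
      · exact Submodule.subset_span ⟨⟨0, by omega⟩, by simp [dualZeta, hk1]⟩
      · rw [truncTh]
        refine Submodule.sum_mem _ fun j _ => ?_
        rw [← zsmul_eq_mul]
        exact Submodule.smul_mem _ _ (pow_mem_span_dualZeta n f (by omega))
  | succ i ih =>
    rcases hk.eq_or_lt with rfl | hk
    · simp [truncTh_self]
    · rw [pow_succ_mul_truncTh]
      exact Submodule.sub_mem _ (ih (by omega) hk)
        (Submodule.smul_mem _ _ (pow_mem_span_dualZeta n f (by omega)))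

theorem zeta_mem_Rf {n : ℕ} (f : ℕ → ℤ) {k : ℕ} (hk : k < n) : zeta n f k ∈ Rf n f :=
  Submodule.subset_span ⟨⟨k, hk⟩, rfl⟩

theorem one_mem_Rf {n : ℕ} (f : ℕ → ℤ) (hn : 0 < n) : 1 ∈ Rf n f := by
  simpa [zeta] using zeta_mem_Rf f hn

theorem Ifpow_eq_span_dualZeta (n : ℕ) (hn : 2 ≤ n) (f : ℕ → ℤ) :
    Ifpow n f (n - 2) = Submodule.span ℤ (Set.range fun k : Fin n => dualZeta n f k) := by
  rw [Ifpow, span_one_pair_pow]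
  apply le_antisymm
  · rw [Rf, Submodule.span_mul_span, Submodule.span_le]
    rintro _ ⟨_, ⟨k, rfl⟩, _, ⟨i, hi, rfl⟩, rfl⟩
    rw [Set.mem_Iic] at hi
    have hpow := pow_mem_span_dualZeta n f (i := i) (by omega)
    simp only [SetLike.mem_coe]
    by_cases hk : (k : ℕ) = 0
    · simpa [zeta, hk] using hpow
    · rw [zeta_eq_truncTh_sub n f hk, sub_mul, mul_comm, ← zsmul_eq_mul]
      exact Submodule.sub_mem _
        (pow_mul_truncTh_mem_span_dualZeta n f (by omega) k.isLt.le)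
        (Submodule.smul_mem _ _ hpow)
  · rw [Submodule.span_le]
    rintro _ ⟨k, rfl⟩
    simp only [SetLike.mem_coe, dualZeta]
    have hpow : ∀ i ≤ n - 2, th n f ^ i ∈
        Submodule.span ℤ ((fun i => th n f ^ i) '' Set.Iic (n - 2)) :=
      fun i hi => Submodule.subset_span ⟨i, hi, rfl⟩
    have h1 := one_mem_Rf f (show 0 < n by omega)
    split_ifs with hk
    · have hmem : truncTh n f (n - 1) ∈ Rf n f := by
        have h := Submodule.add_mem _ (zeta_mem_Rf f (show n - 1 < n by omega))
          (Submodule.smul_mem _ (f (n - 1)) h1)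
        rwa [zeta_eq_truncTh_sub n f (by omega), zsmul_eq_mul, mul_one, sub_add_cancel] at h
      simpa using Submodule.mul_mem_mul hmem (hpow 0 (by omega))
    · simpa using Submodule.mul_mem_mul h1 (hpow (n - 1 - k) (by omega))

/-- `I_f^(n-2)` is isomorphic as an `R_f`-module to `Hom_ℤ(R_f, ℤ)`, where `R_f` acts
on `Hom_ℤ(R_f, ℤ)` by `(r·φ)(s) = φ(rs)`: i.e. `I_f^(n-2)` is the inverse different
of `R_f`. -/
theorem stmt11 (n : ℕ) (hn : 2 ≤ n) (f : ℕ → ℤ) (hf0 : f 0 ≠ 0) :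
    ∃ e : Ifpow n f (n - 2) ≃ₗ[ℤ] (Rf n f →ₗ[ℤ] ℤ),
      ∀ (r : Rf n f) (x : Ifpow n f (n - 2))
        (hrx : (r : Qf n f) * (x : Qf n f) ∈ Ifpow n f (n - 2))
        (s : Rf n f) (hrs : (r : Qf n f) * (s : Qf n f) ∈ Rf n f),
        e ⟨(r : Qf n f) * (x : Qf n f), hrx⟩ s =
          e x ⟨(r : Qf n f) * (s : Qf n f), hrs⟩ := by
  obtain ⟨L, hL⟩ := exists_top_coeff_functional n f hf0
  obtain ⟨e, he⟩ := exists_linearEquiv_dual_of_biorthogonal (L.restrictScalars ℤ)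
    (fun k : Fin n => dualZeta n f k) (fun k : Fin n => zeta n f k) fun i k => by
      simpa [Fin.ext_iff] using map_dualZeta_mul_zeta hn hf0 hL i.isLt k.isLt
  rw [Ifpow_eq_span_dualZeta n hn f]
  refine ⟨e, fun r x hrx s hrs => ?_⟩
  have h : (r : Qf n f) * x * s = x * (r * s) := by ring
  have h1 := he ⟨_, hrx⟩ s
  have h2 := he x ⟨_, hrs⟩
  rw [← Int.cast_inj (α := ℚ)]
  exact h1.trans ((congrArg L h).trans h2.symm)

end
end

section
/- Assume n ≥ 3. There exists an R_f-submodule J of Q_f with I_f^{n−2}·J = R_f (i.e., the fractional ideal I_f^{n−2}, which represents the inverse different of R_f, is invertible — equivalently, R_f is Gorenstein) if and only if gcd(f_0, f_1, …, f_n) = 1 (i.e., the form f is primitive). -/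
open Polynomial

noncomputable section

section Horner

variable {A : Type*} [CommRing A]

/-- The truncation `h₀ t^k + h₁ t^(k-1) + ⋯ + h_(k-1) t`. -/
def horner (t : A) (h : ℕ → ℤ) (k : ℕ) : A :=
  ∑ i ∈ Finset.range k, (h i : A) * t ^ (k - i)

/-- The `ℤ`-span of `1` and the truncations `horner t h k` for `k ≤ n`. -/
def hornerOrder (t : A) (h : ℕ → ℤ) (n : ℕ) : Submodule ℤ A :=
  Submodule.span ℤ (insert 1 (horner t h '' Set.Iic n))

theorem horner_zero (t : A) (h : ℕ → ℤ) : horner t h 0 = 0 := by simp [horner]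

theorem horner_succ (t : A) (h : ℕ → ℤ) (k : ℕ) :
    horner t h (k + 1) = t * (horner t h k + h k) := by
  have : ∀ i ∈ Finset.range k, (h i : A) * t ^ (k + 1 - i) = t * ((h i : A) * t ^ (k - i)) := by
    intro i hi
    rw [Finset.mem_range] at hi
    rw [show k + 1 - i = (k - i) + 1 by omega]
    ring
  rw [horner, Finset.sum_range_succ, Finset.sum_congr rfl this, ← Finset.mul_sum, horner,
    Nat.add_sub_cancel_left]
  ring

theorem one_mem_hornerOrder (t : A) (h : ℕ → ℤ) (n : ℕ) : (1 : A) ∈ hornerOrder t h n :=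
  Submodule.subset_span (Set.mem_insert _ _)

theorem horner_mem_hornerOrder (t : A) (h : ℕ → ℤ) {n k : ℕ} (hk : k ≤ n) :
    horner t h k ∈ hornerOrder t h n :=
  Submodule.subset_span (Set.mem_insert_of_mem _ ⟨k, hk, rfl⟩)

theorem intCast_mul_mem (M : Submodule ℤ A) (c : ℤ) {x : A} (hx : x ∈ M) : (c : A) * x ∈ M := by
  rw [← zsmul_eq_mul]
  exact M.smul_mem c hx

theorem intCast_mem_of_one_mem {M : Submodule ℤ A} (h1 : (1 : A) ∈ M) (c : ℤ) : (c : A) ∈ M := by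
  simpa using intCast_mul_mem M c h1

theorem horner_mul_horner_mem {t : A} {h : ℕ → ℤ} {n : ℕ} (hn : horner t h n = -(h n : A))
    {i j : ℕ} (hi : i ≤ n) (hj : j ≤ n) :
    horner t h i * horner t h j ∈ hornerOrder t h n := by
  induction i generalizing j with
  | zero => simp [horner_zero]
  | succ i ih =>
    rcases hj.eq_or_lt with rfl | hj
    · have := intCast_mul_mem _ (-h j) (horner_mem_hornerOrder t h hi)
      rw [hn]
      convert this using 1
      push_cast
      ring
    · have key : horner t h (i + 1) * horner t h j = horner t h i * horner t h (j + 1) +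
          (h i : A) * horner t h (j + 1) - (h j : A) * horner t h (i + 1) := by
        rw [horner_succ, horner_succ]
        ring
      rw [key]
      exact sub_mem (add_mem (ih (by omega) hj)
        (intCast_mul_mem _ _ (horner_mem_hornerOrder t h hj)))
        (intCast_mul_mem _ _ (horner_mem_hornerOrder t h hi))

theorem hornerOrder_mul_self {t : A} {h : ℕ → ℤ} {n : ℕ} (hn : horner t h n = -(h n : A)) :
    hornerOrder t h n * hornerOrder t h n = hornerOrder t h n := by
  apply le_antisymm
  · conv_lhs => rw [hornerOrder, Submodule.span_mul_span]
    rw [Submodule.span_le]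
    rintro _ ⟨x, hx, y, hy, rfl⟩
    rcases hx with rfl | ⟨i, hi, rfl⟩
    · simpa [hornerOrder] using Submodule.subset_span hy
    · rcases hy with rfl | ⟨j, hj, rfl⟩
      · simpa using horner_mem_hornerOrder t h hi
      · exact horner_mul_horner_mem hn hi hj
  · intro x hx
    simpa using Submodule.mul_mem_mul (one_mem_hornerOrder t h n) hx

theorem hornerOrder_pow {t : A} {h : ℕ → ℤ} {n : ℕ} (hn : horner t h n = -(h n : A)) (k : ℕ) :
    hornerOrder t h n ^ (k + 1) = hornerOrder t h n := by
  induction k with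
  | zero => simp
  | succ k ih => rw [pow_succ, ih, hornerOrder_mul_self hn]

theorem pow_mem_span_pow (t : A) {i k : ℕ} (hi : i ≤ k) :
    t ^ i ∈ (Submodule.span ℤ {1, t} : Submodule ℤ A) ^ k := by
  have h1 : (1 : A) ∈ (Submodule.span ℤ {1, t} : Submodule ℤ A) :=
    Submodule.subset_span (by simp)
  have ht : t ∈ (Submodule.span ℤ {1, t} : Submodule ℤ A) := Submodule.subset_span (by simp)
  rw [← Nat.add_sub_cancel' hi, pow_add]
  simpa using Submodule.mul_mem_mul (Submodule.pow_mem_pow _ ht i)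
    (Submodule.pow_mem_pow _ h1 (k - i))

theorem hornerOrder_mul_span_pow_le {t : A} {h : ℕ → ℤ} {n : ℕ} (hn : horner t h n = -(h n : A))
    (k : ℕ) :
    hornerOrder t h n * Submodule.span ℤ {1, t} ^ k ≤
      Submodule.span ℤ ((fun i => t ^ i) '' Set.Iic k ∪ horner t h '' Set.Iic n) := by
  induction k with
  | zero =>
    rw [pow_zero, mul_one, hornerOrder]
    apply Submodule.span_mono
    rintro x (rfl | hx)
    · exact Or.inl ⟨0, by simp⟩
    · exact Or.inr hx
  | succ k ih =>
    rw [pow_succ, ← mul_assoc]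
    refine (mul_le_mul_left ih _).trans ?_
    rw [Submodule.span_mul_span, Submodule.span_le]
    set N := Submodule.span ℤ ((fun i => t ^ i) '' Set.Iic (k + 1) ∪ horner t h '' Set.Iic n)
    have hpow : ∀ i ≤ k + 1, t ^ i ∈ N := fun i hi => Submodule.subset_span (Or.inl ⟨i, hi, rfl⟩)
    have hhor : ∀ i ≤ n, horner t h i ∈ N := fun i hi => Submodule.subset_span (Or.inr ⟨i, hi, rfl⟩)
    have ht : t ∈ N := by simpa using hpow 1 (by omega)
    rintro _ ⟨x, hx, y, hy, rfl⟩
    rcases hx with ⟨i, hi, rfl⟩ | ⟨i, hi, rfl⟩ <;> rcases hy with rfl | rfl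
    · simpa using hpow i (Nat.le_succ_of_le hi)
    · simpa [pow_succ] using hpow (i + 1) (Nat.succ_le_succ hi)
    · simpa using hhor i hi
    · rcases (Set.mem_Iic.mp hi).eq_or_lt with rfl | hi
      · have := intCast_mul_mem N (-h i) ht
        simpa [hn] using this
      · have key : horner y h i * y = horner y h (i + 1) - (h i : A) * y := by
          rw [horner_succ]
          ring
        change horner y h i * y ∈ N
        rw [key]
        exact sub_mem (hhor _ hi) (intCast_mul_mem N _ ht)

theorem map_horner {B : Type*} [CommRing B] (φ : A →+* B) (t : A) (h : ℕ → ℤ) (k : ℕ) :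
    φ (horner t h k) = horner (φ t) h k := by
  simp [horner]

theorem degree_horner_X_le (h : ℕ → ℤ) (k : ℕ) : (horner (X : ℤ[X]) h k).degree ≤ k := by
  refine (degree_sum_le _ _).trans (Finset.sup_le fun i _ => ?_)
  refine (degree_C_mul_X_pow_le (k - i) (h i)).trans ?_
  exact_mod_cast Nat.sub_le k i

theorem coeff_horner_X (h : ℕ → ℤ) (k : ℕ) : (horner (X : ℤ[X]) h (k + 1)).coeff (k + 1) = h 0 := by
  have hC : ∀ i, ((h i : ℤ) : ℤ[X]) = C (h i) := fun i => by simp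
  simp only [horner, finsetSum_coeff, hC, coeff_C_mul, coeff_X_pow]
  rw [Finset.sum_eq_single 0]
  · simp
  · intro i hi hi0
    rw [if_neg (by omega), mul_zero]
  · simp

theorem exists_aeval_of_mem {t : A} {h : ℕ → ℤ} {n : ℕ}
    (hn : horner t h (n + 2) = -(h (n + 2) : A)) {x : A}
    (hx : x ∈ hornerOrder t h (n + 2) * Submodule.span ℤ {1, t} ^ n) :
    ∃ q : ℤ[X], q.degree < (n + 1 : ℕ) ∧ ∃ c : ℤ, x = aeval t q + c * horner t h (n + 1) := by
  have hle : Submodule.span ℤ ((fun i => t ^ i) '' Set.Iic n ∪ horner t h '' Set.Iic (n + 2)) ≤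
      (degreeLT ℤ (n + 1)).map (aeval t).toLinearMap ⊔
        Submodule.span ℤ {horner t h (n + 1)} := by
    rw [Submodule.span_le]
    have hlow : ∀ q : ℤ[X], q.degree ≤ n → aeval t q ∈
        (degreeLT ℤ (n + 1)).map (aeval t).toLinearMap ⊔
          Submodule.span ℤ {horner t h (n + 1)} := fun q hq =>
      Submodule.mem_sup_left ⟨q, mem_degreeLT.mpr (hq.trans_lt (by norm_cast; omega)), rfl⟩
    rintro _ (⟨i, hi, rfl⟩ | ⟨i, hi, rfl⟩)
    · simpa using hlow (X ^ i) ((degree_X_pow_le i).trans (by exact_mod_cast hi))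
    · rw [Set.mem_Iic] at hi
      rcases (by omega : i ≤ n ∨ i = n + 1 ∨ i = n + 2) with hi | rfl | rfl
      · have := hlow (horner X h i) ((degree_horner_X_le h i).trans (by exact_mod_cast hi))
        have hm := map_horner (aeval t : ℤ[X] →ₐ[ℤ] A).toRingHom X h i
        simp only [AlgHom.toRingHom_eq_coe, RingHom.coe_coe, aeval_X] at hm
        rwa [hm] at this
      · exact Submodule.mem_sup_right (Submodule.mem_span_singleton_self _)
      · have := hlow (C (-h (n + 2))) (degree_C_le.trans (by exact_mod_cast Nat.zero_le n))
        simpa [hn] using this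
  obtain ⟨y, ⟨q, hq, rfl⟩, z, hz, rfl⟩ :=
    Submodule.mem_sup.mp (hle (hornerOrder_mul_span_pow_le hn n hx))
  obtain ⟨c, rfl⟩ := Submodule.mem_span_singleton.mp hz
  exact ⟨q, mem_degreeLT.mp hq, c, by simp⟩

theorem dvd_of_add_eq_mul {t : A} {h : ℕ → ℤ} {n : ℕ} (h0 : h 0 ≠ 0)
    (hn : horner t h (n + 3) = -(h (n + 3) : A))
    (ht : ∀ q : ℤ[X], q.degree < (n + 3 : ℕ) → aeval t q = 0 → q = 0)
    {p a b : ℤ} (hp : p ≠ 0) {x : A}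
    (hx : x ∈ hornerOrder t h (n + 3) * Submodule.span ℤ {1, t} ^ (n + 1))
    (hab : (a : A) + b * t = p * x) : p ∣ a ∧ p ∣ b := by
  obtain ⟨q, hq, c, rfl⟩ := exists_aeval_of_mem hn hx
  have hm := map_horner (aeval t : ℤ[X] →ₐ[ℤ] A).toRingHom X h (n + 2)
  simp only [AlgHom.toRingHom_eq_coe, RingHom.coe_coe, aeval_X] at hm
  have hlt : ∀ m : ℕ, m < n + 3 → ((m : ℕ) : WithBot ℕ) < (n + 3 : ℕ) := by
    intro m hm
    exact_mod_cast hm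
  have hP : C a + C b * X - C p * (q + C c * horner X h (n + 2)) = 0 := by
    apply ht
    · rw [← mem_degreeLT]
      refine sub_mem (add_mem ?_ ?_) ?_
      · exact mem_degreeLT.mpr (degree_C_le.trans_lt (hlt 0 (by omega)))
      · exact mem_degreeLT.mpr ((degree_C_mul_X_le b).trans_lt (hlt 1 (by omega)))
      · rw [← smul_eq_C_mul]
        refine Submodule.smul_mem _ _ (add_mem ?_ ?_)
        · exact mem_degreeLT.mpr (hq.trans (hlt _ (by omega)))
        · rw [← smul_eq_C_mul]
          exact Submodule.smul_mem _ _
            (mem_degreeLT.mpr ((degree_horner_X_le h _).trans_lt (hlt _ (by omega))))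
    · simp [hm, hab]
  have hc : c = 0 := by
    have hcoeff := congrArg (fun r => coeff r (n + 2)) hP
    have hq0 : q.coeff (n + 2) = 0 := coeff_eq_zero_of_degree_lt hq
    simp only [coeff_sub, coeff_add, coeff_C_mul, coeff_horner_X h (n + 1), hq0, coeff_zero,
      coeff_C, coeff_X] at hcoeff
    simpa [hp, h0] using hcoeff
  subst hc
  have e0 := congrArg (fun r => coeff r 0) hP
  have e1 := congrArg (fun r => coeff r 1) hP
  simp only [coeff_sub, coeff_add, coeff_C_mul, coeff_C, coeff_X, coeff_zero, map_zero, zero_mul,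
    add_zero] at e0 e1
  norm_num at e0 e1
  exact ⟨⟨q.coeff 0, by linarith⟩, ⟨q.coeff 1, by linarith⟩⟩

theorem horner_mul (t : A) (p : ℤ) (g : ℕ → ℤ) (k : ℕ) :
    horner t (fun i => p * g i) k = p * horner t g k := by
  simp [horner, Finset.mul_sum, mul_assoc]

theorem exists_of_mem_hornerOrder_mul {t : A} {p : ℤ} {g : ℕ → ℤ} {n : ℕ} {x : A}
    (hx : x ∈ hornerOrder t (fun i => p * g i) n) :
    ∃ c : ℤ, ∃ r ∈ hornerOrder t g n, x = c + p * r := by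
  induction hx using Submodule.span_induction with
  | mem x hx =>
    rcases hx with rfl | ⟨k, hk, rfl⟩
    · exact ⟨1, 0, zero_mem _, by simp⟩
    · exact ⟨0, horner t g k, horner_mem_hornerOrder t g hk, by simp [horner_mul]⟩
  | zero => exact ⟨0, 0, zero_mem _, by simp⟩
  | add x y _ _ hx hy =>
    obtain ⟨c, r, hr, rfl⟩ := hx
    obtain ⟨d, s, hs, rfl⟩ := hy
    exact ⟨c + d, r + s, add_mem hr hs, by push_cast; ring⟩
  | smul m x _ hx =>
    obtain ⟨c, r, hr, rfl⟩ := hx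
    exact ⟨m * c, m * r, intCast_mul_mem _ m hr, by rw [zsmul_eq_mul]; push_cast; ring⟩

theorem hornerOrder_mul_le (t : A) (p : ℤ) (g : ℕ → ℤ) (n : ℕ) :
    hornerOrder t (fun i => p * g i) n ≤ hornerOrder t g n := by
  intro x hx
  obtain ⟨c, r, hr, rfl⟩ := exists_of_mem_hornerOrder_mul hx
  exact add_mem (intCast_mem_of_one_mem (one_mem_hornerOrder t g n) c) (intCast_mul_mem _ p hr)

/-- If all coefficients are divisible by a prime, `I^(n-2)` is not invertible. -/
theorem hornerOrder_mul_span_pow_mul_ne {t : A} {p : ℤ} (hp : Prime p) {g : ℕ → ℤ} {n : ℕ}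
    (h0 : g 0 ≠ 0) (hn : horner t g (n + 3) = -(g (n + 3) : A))
    (ht : ∀ q : ℤ[X], q.degree < (n + 3 : ℕ) → aeval t q = 0 → q = 0) (J : Submodule ℤ A) :
    hornerOrder t (fun i => p * g i) (n + 3) * Submodule.span ℤ {1, t} ^ (n + 1) * J ≠
      hornerOrder t (fun i => p * g i) (n + 3) := by
  intro hJ
  set R := hornerOrder t (fun i => p * g i) (n + 3)
  set O := hornerOrder t g (n + 3)
  set V := (Submodule.span ℤ {1, t} : Submodule ℤ A) ^ (n + 1)
  have hOO : O * O = O := hornerOrder_mul_self hn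
  have hRO : R ≤ O := hornerOrder_mul_le t p g (n + 3)
  have hV1 : (1 : A) ∈ V := by simpa using pow_mem_span_pow t (Nat.zero_le (n + 1))
  have hVt : t ∈ V := by simpa using pow_mem_span_pow t (Nat.le_add_left 1 n)
  have hR1 : (1 : A) ∈ R := one_mem_hornerOrder _ _ _
  have hO1 : (1 : A) ∈ O := one_mem_hornerOrder _ _ _
  have hOS : ∀ r ∈ O, r ∈ O * V := fun r hr => by simpa using Submodule.mul_mem_mul hr hV1
  have key : ∀ {a b : ℤ} {x : A}, x ∈ O * V → (a : A) + b * t = p * x → p ∣ a ∧ p ∣ b :=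
    fun hx hab => dvd_of_add_eq_mul h0 hn ht hp.ne_zero hx hab
  have hpunit : ¬ p ∣ 1 := fun h => hp.not_isUnit (isUnit_of_dvd_one h)
  have hex : ∃ m ∈ R * V, ∃ j ∈ J, ∀ r ∈ O, m * j ≠ p * r := by
    by_contra! hcon
    have hle : R * V * J ≤ O.map (LinearMap.mulLeft ℤ (p : A)) := by
      rw [Submodule.mul_le]
      intro m hm j hj
      obtain ⟨r, hr, h⟩ := hcon m hm j hj
      exact ⟨r, hr, by simp [h]⟩
    rw [hJ] at hle
    obtain ⟨r, hr, h⟩ := hle hR1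
    refine hpunit (key (a := 1) (b := 0) (hOS r hr) ?_).1
    simpa using h.symm
  obtain ⟨m, hm, j, hj, hmj⟩ := hex
  have hmul : ∀ x ∈ R * V, ∃ c : ℤ, ∃ r ∈ O, x * j = c + p * r := fun x hx =>
    exists_of_mem_hornerOrder_mul (hJ.le (Submodule.mul_mem_mul hx hj))
  obtain ⟨c, r, hr, hc⟩ := hmul m hm
  obtain ⟨c₁, r₁, hr₁, hc₁⟩ := hmul 1 (by simpa using Submodule.mul_mem_mul hR1 hV1)
  obtain ⟨c₂, r₂, hr₂, hc₂⟩ := hmul t (by simpa using Submodule.mul_mem_mul hR1 hVt)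
  have hpc : ¬ p ∣ c := by
    rintro ⟨d, rfl⟩
    refine hmj (d + r) (add_mem (intCast_mem_of_one_mem hO1 d) hr) ?_
    rw [hc]
    push_cast
    ring
  have hmS : m ∈ O * V := mul_le_mul_left hRO V hm
  have hOm : ∀ s ∈ O, s * m ∈ O * V := fun s hs => by
    have := Submodule.mul_mem_mul hs hmS
    rwa [← mul_assoc, hOO] at this
  have htr : t * r ∈ O * V := by
    rw [mul_comm t r]
    exact Submodule.mul_mem_mul hr hVt
  have hd : p ∣ -(c * c₁) := by
    refine (key (a := c * c₂) (b := -(c * c₁))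
      (x := c₂ * (r₁ * m) - c₂ * r - c₁ * (r₂ * m) + c₁ * (t * r)) ?_ ?_).2
    · exact add_mem (sub_mem (sub_mem (intCast_mul_mem _ _ (hOm _ hr₁))
        (intCast_mul_mem _ _ (hOS r hr))) (intCast_mul_mem _ _ (hOm _ hr₂)))
        (intCast_mul_mem _ _ htr)
    · push_cast
      linear_combination (c₁ * t - c₂ : A) * hc + (c₂ * m : A) * hc₁ - (c₁ * m : A) * hc₂
  obtain ⟨d, rfl⟩ := (hp.dvd_or_dvd ((dvd_neg).mp hd)).resolve_left hpc
  refine hpc (key (a := c) (b := 0) (x := d * m + r₁ * m - r) ?_ ?_).1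
  · exact sub_mem (add_mem (intCast_mul_mem _ _ hmS) (hOm _ hr₁)) (hOS r hr)
  · push_cast at hc₁ ⊢
    linear_combination (m : A) * hc₁ - hc

/-- If the coefficients generate the unit ideal, `I` is invertible. -/
theorem span_mul_span_eq_hornerOrder {t : A} {f : ℕ → ℤ} {n : ℕ}
    (hn : horner t f n = -(f n : A)) (hf : (Finset.range (n + 1)).gcd f = 1) :
    Submodule.span ℤ {1, t} * Submodule.span ℤ ((fun k => horner t f k + f k) '' Set.Iic n) =
      hornerOrder t f n := by
  apply le_antisymm
  · rw [Submodule.span_mul_span, Submodule.span_le]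
    rintro _ ⟨x, hx, _, ⟨k, hk, rfl⟩, rfl⟩
    rw [Set.mem_Iic] at hk
    rcases hx with rfl | rfl
    · simpa using add_mem (horner_mem_hornerOrder t f hk)
        (intCast_mem_of_one_mem (one_mem_hornerOrder t f n) (f k))
    · change x * (horner x f k + f k) ∈ _
      rcases hk.eq_or_lt with rfl | hk
      · simp [hn]
      · rw [← horner_succ]
        exact horner_mem_hornerOrder x f hk
  · set N := Submodule.span ℤ {1, t} * Submodule.span ℤ ((fun k => horner t f k + f k) '' Set.Iic n)
    have hgen : ∀ k ≤ n, ∀ x ∈ ({1, t} : Set A), x * (horner t f k + f k) ∈ N := fun k hk x hx =>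
      Submodule.mul_mem_mul (Submodule.subset_span hx) (Submodule.subset_span ⟨k, hk, rfl⟩)
    have hhor : ∀ k ≤ n, horner t f k ∈ N := by
      intro k hk
      cases k with
      | zero => simp [horner_zero]
      | succ k =>
        rw [horner_succ]
        exact hgen k (by omega) t (by simp)
    have hcoe : ∀ k ≤ n, (f k : A) ∈ N := by
      intro k hk
      simpa using sub_mem (hgen k hk 1 (by simp)) (hhor k hk)
    have h1 : (1 : A) ∈ N := by
      obtain ⟨u, hu⟩ := (Finset.range (n + 1)).gcd_eq_sum_mul f
      rw [hf] at hu
      have hcast := congrArg (fun z : ℤ => (z : A)) hu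
      simp only [Int.cast_one, Int.cast_sum, Int.cast_mul] at hcast
      rw [hcast]
      refine sum_mem fun i hi => ?_
      rw [mul_comm]
      exact intCast_mul_mem N _ (hcoe i (Nat.lt_succ_iff.mp (Finset.mem_range.mp hi)))
    rw [hornerOrder, Submodule.span_le]
    rintro _ (rfl | ⟨k, hk, rfl⟩)
    · exact h1
    · exact hhor k hk

end Horner

theorem eval₂_fpoly (n : ℕ) (f : ℕ → ℤ) {B : Type*} [CommRing B] (φ : ℚ →+* B) (x : B) :
    eval₂ φ x (fpoly n f) = ∑ i ∈ Finset.range (n + 1), (f i : B) * x ^ (n - i) := by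
  rw [fpoly, eval₂_finsetSum]
  refine Finset.sum_congr rfl fun i _ => ?_
  rw [eval₂_mul, eval₂_C, eval₂_X_pow, map_intCast]

theorem sum_coeff_mul_th_pow (n : ℕ) (f : ℕ → ℤ) :
    ∑ i ∈ Finset.range (n + 1), (f i : Qf n f) * th n f ^ (n - i) = 0 := by
  rw [← eval₂_fpoly n f (AdjoinRoot.of (fpoly n f))]
  exact AdjoinRoot.eval₂_root (fpoly n f)

theorem degree_fpoly {n : ℕ} {f : ℕ → ℤ} (hf0 : f 0 ≠ 0) : (fpoly n f).degree = n := by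
  rw [fpoly, Finset.sum_range_succ']
  simp only [Nat.sub_zero]
  have hlead : (C (f 0 : ℚ) * X ^ n : ℚ[X]).degree = (n : WithBot ℕ) :=
    degree_C_mul_X_pow n (Int.cast_ne_zero.mpr hf0)
  rw [degree_add_eq_right_of_degree_lt, hlead]
  rw [hlead]
  refine (degree_sum_le _ _).trans_lt ((Finset.sup_lt_iff (WithBot.bot_lt_coe n)).mpr ?_)
  intro i hi
  rw [Finset.mem_range] at hi
  refine (degree_C_mul_X_pow_le _ _).trans_lt ?_
  exact Nat.cast_lt.mpr (by omega)

theorem eq_zero_of_aeval_th {n : ℕ} {f : ℕ → ℤ} (hf0 : f 0 ≠ 0) (q : ℤ[X])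
    (hq : q.degree < n) (h : aeval (th n f) q = 0) : q = 0 := by
  have hmk : aeval (th n f) q = AdjoinRoot.mk (fpoly n f) (q.map (Int.castRingHom ℚ)) := by
    rw [← AdjoinRoot.aeval_eq, ← algebraMap_int_eq, aeval_map_algebraMap]
    rfl
  rw [hmk, AdjoinRoot.mk_eq_zero] at h
  have hz : q.map (Int.castRingHom ℚ) = 0 := by
    refine eq_zero_of_dvd_of_degree_lt h ?_
    rw [degree_fpoly hf0]
    exact degree_map_le.trans_lt hq
  exact (Polynomial.map_eq_zero_iff (RingHom.injective_int _)).mp hz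

theorem Rf_eq_hornerOrder {n : ℕ} (hn : 0 < n) {f : ℕ → ℤ}
    (h : horner (th n f) f n = -(f n : Qf n f)) : Rf n f = hornerOrder (th n f) f n := by
  have hz : ∀ k, k ≠ 0 → zeta n f k = horner (th n f) f k := fun k hk => by
    rw [zeta, if_neg hk, horner]
  have h1 : (1 : Qf n f) ∈ Rf n f := Submodule.subset_span ⟨⟨0, hn⟩, by simp [zeta]⟩
  apply le_antisymm
  · rw [Rf, Submodule.span_le]
    rintro _ ⟨k, rfl⟩
    by_cases hk : (k : ℕ) = 0
    · simpa [zeta, hk] using one_mem_hornerOrder (th n f) f n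
    · simpa [hz _ hk] using horner_mem_hornerOrder (th n f) f k.2.le
  · rw [hornerOrder, Submodule.span_le]
    rintro _ (rfl | ⟨k, hk, rfl⟩)
    · exact h1
    · rcases (Set.mem_Iic.mp hk).eq_or_lt with rfl | hk
      · rw [h]
        exact neg_mem (intCast_mem_of_one_mem h1 _)
      · rcases Nat.eq_zero_or_pos k with rfl | hk0
        · simp [horner_zero]
        · exact Submodule.subset_span ⟨⟨k, hk⟩, hz k hk0.ne'⟩

/-- For `n ≥ 3`, the fractional ideal `I_f^(n-2)` (representing the inverse different of
`R_f`) is invertible — equivalently, `R_f` is Gorenstein — if and only if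
`gcd(f₀, …, f_n) = 1`, i.e. `f` is primitive. -/
theorem stmt13 (n : ℕ) (hn : 3 ≤ n) (f : ℕ → ℤ) (hf0 : f 0 ≠ 0) :
    (∃ J : Submodule ℤ (Qf n f),
        (∀ r ∈ Rf n f, ∀ x ∈ J, r * x ∈ J) ∧ Ifpow n f (n - 2) * J = Rf n f) ↔
      Finset.gcd (Finset.range (n + 1)) f = 1 := by
  obtain ⟨n, rfl⟩ := Nat.exists_eq_add_of_le' hn
  have hroot : horner (th (n + 3) f) f (n + 3) = -(f (n + 3) : Qf (n + 3) f) := by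
    have h := sum_coeff_mul_th_pow (n + 3) f
    rw [Finset.sum_range_succ, Nat.sub_self, pow_zero, mul_one] at h
    exact eq_neg_of_add_eq_zero_left h
  have hR := Rf_eq_hornerOrder (by omega) hroot
  rw [Ifpow, hR, show n + 3 - 2 = n + 1 by omega]
  constructor
  · rintro ⟨J, -, hJ⟩
    by_contra hne
    obtain ⟨p, hp, hpd⟩ := Int.exists_prime_and_dvd
      (n := (Finset.range (n + 3 + 1)).gcd f) (by
        intro h
        rw [← Int.isUnit_iff_natAbs_eq, ← normalize_eq_one, Finset.normalize_gcd] at h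
        exact hne h)
    have hdvd : ∀ i ≤ n + 3, f i = p * (f i / p) := fun i hi =>
      (Int.mul_ediv_cancel' (hpd.trans (Finset.gcd_dvd (by simp; omega)))).symm
    have hhor : ∀ k ≤ n + 3, horner (th (n + 3) f) f k =
        horner (th (n + 3) f) (fun i => p * (f i / p)) k := fun k hk =>
      Finset.sum_congr rfl fun i hi => by
        rw [Finset.mem_range] at hi
        exact congrArg (fun z : ℤ => (z : Qf (n + 3) f) * _) (hdvd i (by omega))
    have hord : hornerOrder (th (n + 3) f) f (n + 3) =
        hornerOrder (th (n + 3) f) (fun i => p * (f i / p)) (n + 3) := by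
      rw [hornerOrder, hornerOrder, Set.image_congr (s := Set.Iic (n + 3)) hhor]
    rw [hord] at hJ
    refine hornerOrder_mul_span_pow_mul_ne hp ?_ ?_ (eq_zero_of_aeval_th hf0) J hJ
    · intro h
      exact hf0 (by rw [hdvd 0 (by omega), h, mul_zero])
    · rw [hhor _ le_rfl, horner_mul, hdvd _ le_rfl, Int.cast_mul, ← mul_neg] at hroot
      have hu : IsUnit (p : Qf (n + 3) f) := by
        have := (IsUnit.mk0 (p : ℚ) (by exact_mod_cast hp.ne_zero)).map
          (algebraMap ℚ (Qf (n + 3) f))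
        simpa using this
      exact hu.mul_left_cancel hroot
  · intro hgcd
    set t := th (n + 3) f
    set O := hornerOrder t f (n + 3)
    set K := Submodule.span ℤ ((fun k => horner t f k + f k) '' Set.Iic (n + 3))
    have hOO : O * O = O := hornerOrder_mul_self hroot
    refine ⟨O * K ^ (n + 1), fun r hr x hx => ?_, ?_⟩
    · have := Submodule.mul_mem_mul hr hx
      rwa [← mul_assoc, hOO] at this
    · rw [mul_mul_mul_comm, hOO, ← mul_pow, span_mul_span_eq_hornerOrder hroot hgcd,
        hornerOrder_pow hroot, hOO]

end
end
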